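/- For each t > 0, x ∈ ℝ and y > 0 define θ(t; x, y) = Σ_{(m,n) ∈ ℤ² \ {(0,0)}} exp(−(t/y)·((m + n·x)² + n²·y²)). Then for every t > 0 and every (x, y) with 0 ≤ x ≤ 1/2, y > 0 and x² + y² ≥ 1, the partial derivative ∂θ/∂y (t; x, y) is nonnegative, and it is zero if and only if (x, y) = (0, 1) or (x, y) = (1/2, √3/2). -/

import Mathlib

noncomputable section

/-- `θ(t; x, y) = ∑_{(m,n) ∈ ℤ²\{0}} exp (-(t/y)((m + n x)² + n² y²))`,
which is `F_t` of the unimodular lattice associated to `z = x + i y`. -/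
def theta (t x y : ℝ) : ℝ :=
  ∑' p : {p : ℤ × ℤ // p ≠ (0, 0)},
    Real.exp (-(t / y) * (((p.1.1 : ℝ) + (p.1.2 : ℝ) * x) ^ 2 + (p.1.2 : ℝ) ^ 2 * y ^ 2))

/-- The general term of the theta series. -/
def Ex (t x y : ℝ) (p : ℤ × ℤ) : ℝ :=
  Real.exp (-(t / y) * (((p.1 : ℝ) + (p.2 : ℝ) * x) ^ 2 + (p.2 : ℝ) ^ 2 * y ^ 2))

/-- A dominating weight. -/
def Wt (c : ℝ) (p : ℤ × ℤ) : ℝ :=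
  (1 + (p.1 : ℝ) ^ 2 + (p.2 : ℝ) ^ 2) ^ 2 * Real.exp (-c * ((p.1 : ℝ) ^ 2 + (p.2 : ℝ) ^ 2))

lemma Ex_pos (t x y : ℝ) (p : ℤ × ℤ) : 0 < Ex t x y p := Real.exp_pos _

lemma summable_gauss (c v : ℝ) (hc : 0 < c) :
    Summable (fun m : ℤ => Real.exp (-c * ((m : ℝ) + v) ^ 2)) := by
  have h := (HurwitzZeta.hasSum_int_evenKernel v (t := c / Real.pi) (by positivity)).summable
  refine h.congr fun m => ?_
  congr 1
  have := Real.pi_pos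
  field_simp

lemma summable_Wt (c : ℝ) (hc : 0 < c) : Summable (Wt c) := by
  set d := c / 2 with hd
  have hd0 : 0 < d := by positivity
  have h1 : Summable (fun m : ℤ => Real.exp (-d * (m : ℝ) ^ 2)) := by
    simpa using summable_gauss d 0 hd0
  have h2 := (h1.mul_of_nonneg h1 (fun _ => (Real.exp_pos _).le)
    (fun _ => (Real.exp_pos _).le)).mul_left (2 / d ^ 2 * Real.exp d)
  refine Summable.of_nonneg_of_le (fun p => ?_) (fun p => ?_) h2
  · unfold Wt; positivity
  · unfold Wt
    set v := (p.1 : ℝ) ^ 2 + (p.2 : ℝ) ^ 2 with hv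
    have hv0 : 0 ≤ v := by positivity
    have e1 : Real.exp (-d * (p.1 : ℝ) ^ 2) * Real.exp (-d * (p.2 : ℝ) ^ 2)
        = Real.exp (-d * v) := by
      rw [← Real.exp_add]; congr 1; rw [hv]; ring
    have e2 : (1 + (p.1 : ℝ) ^ 2 + (p.2 : ℝ) ^ 2) = 1 + v := by rw [hv]; ring
    rw [e1, e2]
    have e3 := Real.quadratic_le_exp_of_nonneg (x := d * (1 + v)) (by positivity)
    have e4 : (1 + v) ^ 2 ≤ 2 / d ^ 2 * Real.exp (d * (1 + v)) := by
      rw [div_mul_eq_mul_div, le_div_iff₀ (by positivity)]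
      nlinarith [mul_nonneg hd0.le (by positivity : (0:ℝ) ≤ 1 + v)]
    calc (1 + v) ^ 2 * Real.exp (-c * v)
        ≤ 2 / d ^ 2 * Real.exp (d * (1 + v)) * Real.exp (-c * v) := by gcongr
      _ = 2 / d ^ 2 * Real.exp d * Real.exp (-d * v) := by
        rw [mul_assoc, mul_assoc, ← Real.exp_add, ← Real.exp_add]
        congr 2
        rw [hd]; ring

lemma Ex_le (t x a b y : ℝ) (ht : 0 < t) (ha : 0 < a) (hay : a ≤ y) (hyb : y ≤ b) (p : ℤ × ℤ) :
    Ex t x y p ≤ Real.exp (-(t / (b * (2 + (2 * x ^ 2 + 1) / a ^ 2))) *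
      ((p.1 : ℝ) ^ 2 + (p.2 : ℝ) ^ 2)) := by
  unfold Ex
  rw [Real.exp_le_exp]
  have hy : 0 < y := ha.trans_le hay
  set m : ℝ := (p.1 : ℝ)
  set n : ℝ := (p.2 : ℝ)
  set K := 2 + (2 * x ^ 2 + 1) / a ^ 2 with hK
  have hK0 : 0 < K := by positivity
  have h1 : m ^ 2 + n ^ 2 ≤ K * ((m + n * x) ^ 2 + n ^ 2 * y ^ 2) := by
    have h2 : (2 * x ^ 2 + 1) * n ^ 2 ≤ (2 * x ^ 2 + 1) / a ^ 2 * (n ^ 2 * y ^ 2) := by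
      rw [div_mul_eq_mul_div, le_div_iff₀ (by positivity)]
      have : a ^ 2 ≤ y ^ 2 := by gcongr
      nlinarith [mul_le_mul_of_nonneg_left this (by positivity : 0 ≤ (2 * x ^ 2 + 1) * n ^ 2)]
    have h3 : 0 ≤ (2 * x ^ 2 + 1) / a ^ 2 * (m + n * x) ^ 2 := by positivity
    have h4 : 0 ≤ n ^ 2 * y ^ 2 := by positivity
    rw [hK]
    nlinarith [sq_nonneg (m + 2 * n * x)]
  have h5 : t / (b * K) * (m ^ 2 + n ^ 2) ≤ t / y * ((m + n * x) ^ 2 + n ^ 2 * y ^ 2) := by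
    calc t / (b * K) * (m ^ 2 + n ^ 2) ≤ t / (y * K) * (K * ((m + n * x) ^ 2 + n ^ 2 * y ^ 2)) := by
          gcongr
      _ = _ := by field_simp
  linarith

/-- Constant in the domination. -/
lemma exists_dom (t x y : ℝ) (ht : 0 < t) (hy : 0 < y) :
    ∃ c : ℝ, 0 < c ∧ ∀ z ∈ Set.Ioo (y / 2) (2 * y), ∀ p : ℤ × ℤ,
      (1 + (p.1 : ℝ) ^ 2 + (p.2 : ℝ) ^ 2) ^ 2 * Ex t x z p ≤ Wt c p := by
  refine ⟨t / (2 * y * (2 + (2 * x ^ 2 + 1) / (y / 2) ^ 2)), by positivity, fun z hz p => ?_⟩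
  unfold Wt
  have := Ex_le t x (y / 2) (2 * y) z ht (by positivity) hz.1.le hz.2.le p
  gcongr

lemma summable_poly (t x y : ℝ) (ht : 0 < t) (hy : 0 < y) (f : ℤ × ℤ → ℝ) (C : ℝ)
    (hf : ∀ p : ℤ × ℤ, |f p| ≤ C * (1 + (p.1 : ℝ) ^ 2 + (p.2 : ℝ) ^ 2) ^ 2) :
    Summable (fun p => f p * Ex t x y p) := by
  obtain ⟨c, hc, h⟩ := exists_dom t x y ht hy
  have hC : 0 ≤ C := by
    have := (abs_nonneg _).trans (hf (0, 0))
    simpa using this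
  refine Summable.of_norm_bounded ((summable_Wt c hc).mul_left C) fun p => ?_
  rw [Real.norm_eq_abs, abs_mul, abs_of_pos (Ex_pos _ _ _ _)]
  have h1 := h y ⟨by linarith, by linarith⟩ p
  calc |f p| * Ex t x y p ≤ C * (1 + (p.1 : ℝ) ^ 2 + (p.2 : ℝ) ^ 2) ^ 2 * Ex t x y p := by
        have := (Ex_pos t x y p).le
        gcongr
        exact hf p
    _ ≤ C * Wt c p := by rw [mul_assoc]; gcongr

lemma summable_Ex (t x y : ℝ) (ht : 0 < t) (hy : 0 < y) : Summable (Ex t x y) := by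
  have := summable_poly t x y ht hy (fun _ => 1) 1 (fun p => by
    rw [abs_one, one_mul]
    nlinarith [sq_nonneg (p.1 : ℝ), sq_nonneg (p.2 : ℝ)])
  simpa using this

lemma theta_eq (t x y : ℝ) (ht : 0 < t) (hy : 0 < y) :
    theta t x y = ∑' p, Ex t x y p - 1 := by
  have h := (summable_Ex t x y ht hy).tsum_eq_add_tsum_ite (0, 0)
  rw [h]
  have e : Ex t x y (0, 0) = 1 := by simp [Ex]
  rw [e]
  have : theta t x y = ∑' p : {p : ℤ × ℤ | p ≠ (0, 0)}, Ex t x y p := rfl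
  rw [this, tsum_subtype]
  rw [add_sub_cancel_left]
  refine tsum_congr fun p => ?_
  by_cases hp : p = (0, 0) <;> simp [hp]

/-- termwise `y² ∂_y`. -/
def Ac (t x y : ℝ) (p : ℤ × ℤ) : ℝ := t * (((p.1 : ℝ) + (p.2 : ℝ) * x) ^ 2 - (p.2 : ℝ) ^ 2 * y ^ 2)

def Bc (t x y : ℝ) (p : ℤ × ℤ) : ℝ :=
  t * (t * (((p.1 : ℝ) + (p.2 : ℝ) * x) ^ 2 / y - (p.2 : ℝ) ^ 2 * y) ^ 2 - 2 * (p.2 : ℝ) ^ 2 * y)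

lemma sq_bound (x : ℝ) (p : ℤ × ℤ) :
    ((p.1 : ℝ) + (p.2 : ℝ) * x) ^ 2 ≤ (2 + 2 * x ^ 2) * (1 + (p.1 : ℝ) ^ 2 + (p.2 : ℝ) ^ 2) := by
  nlinarith [sq_nonneg ((p.1 : ℝ) - (p.2 : ℝ) * x), sq_nonneg (p.1 : ℝ), sq_nonneg (p.2 : ℝ),
    sq_nonneg (x * p.1), sq_nonneg x]

lemma Ac_bound (t x y b : ℝ) (ht : 0 < t) (hy : 0 < y) (hb : y ≤ b) (p : ℤ × ℤ) :
    |Ac t x y p| ≤ t * (2 + 2 * x ^ 2 + b ^ 2) * (1 + (p.1 : ℝ) ^ 2 + (p.2 : ℝ) ^ 2) := by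
  unfold Ac
  rw [abs_mul, abs_of_pos ht, mul_assoc]
  refine mul_le_mul_of_nonneg_left ?_ ht.le
  have h1 := sq_bound x p
  have h2 : y ^ 2 ≤ b ^ 2 := by gcongr
  have h3 : (p.2 : ℝ) ^ 2 * y ^ 2 ≤ (1 + (p.1 : ℝ) ^ 2 + (p.2 : ℝ) ^ 2) * b ^ 2 := by
    gcongr
    nlinarith [sq_nonneg (p.1 : ℝ)]
  rw [abs_le]
  constructor <;> nlinarith [sq_nonneg ((p.1 : ℝ) + (p.2 : ℝ) * x), mul_nonneg (sq_nonneg (p.2:ℝ)) (sq_nonneg y)]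

lemma le_sq_of_one (v : ℝ) (hv : 0 ≤ v) : 1 + v ≤ (1 + v) ^ 2 := by nlinarith

lemma Bc_bound (t x y a b : ℝ) (ht : 0 < t) (ha : 0 < a) (hay : a ≤ y) (hb : y ≤ b) (p : ℤ × ℤ) :
    |Bc t x y p| ≤ t * (t * ((2 + 2 * x ^ 2) / a + b) ^ 2 + 2 * b) *
      (1 + (p.1 : ℝ) ^ 2 + (p.2 : ℝ) ^ 2) ^ 2 := by
  unfold Bc
  have hy : 0 < y := ha.trans_le hay
  have hb0 : 0 < b := hy.trans_le hb
  rw [abs_mul, abs_of_pos ht, mul_assoc t _ ((1 + (p.1 : ℝ) ^ 2 + (p.2 : ℝ) ^ 2) ^ 2)]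
  refine mul_le_mul_of_nonneg_left ?_ ht.le
  set v := 1 + (p.1 : ℝ) ^ 2 + (p.2 : ℝ) ^ 2 with hv
  have hv1 : 1 ≤ v := by rw [hv]; nlinarith [sq_nonneg (p.1 : ℝ), sq_nonneg (p.2 : ℝ)]
  have hn : (p.2 : ℝ) ^ 2 ≤ v := by rw [hv]; nlinarith [sq_nonneg (p.1 : ℝ)]
  have h1 : ((p.1 : ℝ) + (p.2 : ℝ) * x) ^ 2 / y ≤ (2 + 2 * x ^ 2) / a * v := by
    calc ((p.1 : ℝ) + (p.2 : ℝ) * x) ^ 2 / y ≤ ((2 + 2 * x ^ 2) * v) / a := by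
          gcongr
          exact sq_bound x p
      _ = _ := by ring
  have h1' : 0 ≤ ((p.1 : ℝ) + (p.2 : ℝ) * x) ^ 2 / y := by positivity
  have h2 : (p.2 : ℝ) ^ 2 * y ≤ v * b := by gcongr
  have h2' : 0 ≤ (p.2 : ℝ) ^ 2 * y := by positivity
  have h3 : (((p.1 : ℝ) + (p.2 : ℝ) * x) ^ 2 / y - (p.2 : ℝ) ^ 2 * y) ^ 2 ≤
      (((2 + 2 * x ^ 2) / a + b) * v) ^ 2 := by
    apply sq_le_sq'
    · have : 0 ≤ (2 + 2 * x ^ 2) / a * v := by positivity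
      nlinarith
    · have : 0 ≤ v * b := by positivity
      nlinarith
  have h4 : v * b ≤ v ^ 2 * b := by
    gcongr; nlinarith
  have h5 := mul_le_mul_of_nonneg_left h3 ht.le
  have h6 : 0 ≤ t * (((p.1 : ℝ) + (p.2 : ℝ) * x) ^ 2 / y - (p.2 : ℝ) ^ 2 * y) ^ 2 := by positivity
  have h7 : 0 ≤ t * ((2 + 2 * x ^ 2) / a + b) ^ 2 * v ^ 2 := by positivity
  have h8 : 0 ≤ b * v ^ 2 := by positivity
  rw [abs_le]
  constructor <;> nlinarith

lemma hasDerivAt_Ex (t x y : ℝ) (hy : 0 < y) (p : ℤ × ℤ) :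
    HasDerivAt (fun z => Ex t x z p) (Ac t x y p / y ^ 2 * Ex t x y p) y := by
  unfold Ex
  have h1 : HasDerivAt (fun z : ℝ => -(t / z) * (((p.1 : ℝ) + (p.2 : ℝ) * x) ^ 2
      + (p.2 : ℝ) ^ 2 * z ^ 2)) (Ac t x y p / y ^ 2) y := by
    have h2 := (((hasDerivAt_id y).inv hy.ne').const_mul (-t)).mul
      (((hasDerivAt_id y).pow 2).const_mul ((p.2 : ℝ) ^ 2) |>.const_add
        (((p.1 : ℝ) + (p.2 : ℝ) * x) ^ 2))
    refine (h2.congr_of_eventuallyEq ?_).congr_deriv ?_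
    · filter_upwards with z
      simp [div_eq_mul_inv]
    · unfold Ac
      simp
      field_simp
      ring
  exact h1.exp.congr_deriv (mul_comm _ _)

lemma hasDerivAt_AcEx (t x y : ℝ) (hy : 0 < y) (p : ℤ × ℤ) :
    HasDerivAt (fun z => Ac t x z p * Ex t x z p) (Bc t x y p * Ex t x y p) y := by
  have h1 : HasDerivAt (fun z => Ac t x z p) (-(2 * t * (p.2 : ℝ) ^ 2 * y)) y := by
    unfold Ac
    have := ((((hasDerivAt_id y).pow 2).const_mul ((p.2 : ℝ) ^ 2)).const_sub
        (((p.1 : ℝ) + (p.2 : ℝ) * x) ^ 2)).const_mul t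
    refine this.congr_deriv ?_
    simp; ring
  refine (h1.mul (hasDerivAt_Ex t x y hy p)).congr_deriv ?_
  unfold Bc Ac
  field_simp
  ring

lemma hasDerivAt_sumEx (t x y : ℝ) (ht : 0 < t) (hy : 0 < y) :
    HasDerivAt (fun z => ∑' p, Ex t x z p) (∑' p, Ac t x y p / y ^ 2 * Ex t x y p) y := by
  obtain ⟨c, hc, h⟩ := exists_dom t x y ht hy
  have hmem : y ∈ Set.Ioo (y / 2) (2 * y) := ⟨by linarith, by linarith⟩
  refine hasDerivAt_tsum_of_isPreconnected
    (u := fun p => t * (2 + 2 * x ^ 2 + (2 * y) ^ 2) / (y / 2) ^ 2 * Wt c p)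
    ((summable_Wt c hc).mul_left _) isOpen_Ioo isPreconnected_Ioo
    (fun p z hz => hasDerivAt_Ex t x z (by linarith [hz.1]) p) (fun p z hz => ?_) hmem
    (summable_Ex t x y ht hy) hmem
  have hz0 : 0 < z := by linarith [hz.1]
  have h1 := Ac_bound t x z (2 * y) ht hz0 hz.2.le p
  have h2 := h z hz p
  rw [Real.norm_eq_abs, abs_mul, abs_of_pos (Ex_pos _ _ _ _), abs_div, abs_of_pos (by positivity : 0 < z ^ 2)]
  have h3 := le_sq_of_one ((p.1 : ℝ) ^ 2 + (p.2 : ℝ) ^ 2) (by positivity)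
  rw [← add_assoc] at h3
  have h4 := (Ex_pos t x z p).le
  calc |Ac t x z p| / z ^ 2 * Ex t x z p
      ≤ (t * (2 + 2 * x ^ 2 + (2 * y) ^ 2) * (1 + (p.1 : ℝ) ^ 2 + (p.2 : ℝ) ^ 2) ^ 2) / (y / 2) ^ 2
          * Ex t x z p := by
        gcongr
        · exact h1.trans (by gcongr)
        · exact hz.1.le
    _ = t * (2 + 2 * x ^ 2 + (2 * y) ^ 2) / (y / 2) ^ 2 *
        ((1 + (p.1 : ℝ) ^ 2 + (p.2 : ℝ) ^ 2) ^ 2 * Ex t x z p) := by ring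
    _ ≤ _ := by gcongr

lemma summable_Ac (t x y : ℝ) (ht : 0 < t) (hy : 0 < y) :
    Summable (fun p => Ac t x y p * Ex t x y p) := by
  refine summable_poly t x y ht hy _ (t * (2 + 2 * x ^ 2 + y ^ 2)) fun p => ?_
  refine (Ac_bound t x y y ht hy le_rfl p).trans ?_
  have h3 := le_sq_of_one ((p.1 : ℝ) ^ 2 + (p.2 : ℝ) ^ 2) (by positivity)
  rw [← add_assoc] at h3
  gcongr

lemma summable_Bc (t x y : ℝ) (ht : 0 < t) (hy : 0 < y) :
    Summable (fun p => Bc t x y p * Ex t x y p) :=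
  summable_poly t x y ht hy _ _ fun p => Bc_bound t x y y y ht hy le_rfl le_rfl p

lemma hasDerivAt_sumAc (t x y : ℝ) (ht : 0 < t) (hy : 0 < y) :
    HasDerivAt (fun z => ∑' p, Ac t x z p * Ex t x z p) (∑' p, Bc t x y p * Ex t x y p) y := by
  obtain ⟨c, hc, h⟩ := exists_dom t x y ht hy
  have hmem : y ∈ Set.Ioo (y / 2) (2 * y) := ⟨by linarith, by linarith⟩
  refine hasDerivAt_tsum_of_isPreconnected
    (u := fun p => t * (t * ((2 + 2 * x ^ 2) / (y / 2) + 2 * y) ^ 2 + 2 * (2 * y)) * Wt c p)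
    ((summable_Wt c hc).mul_left _) isOpen_Ioo isPreconnected_Ioo
    (fun p z hz => hasDerivAt_AcEx t x z (by linarith [hz.1]) p) (fun p z hz => ?_) hmem
    (summable_Ac t x y ht hy) hmem
  have h1 := Bc_bound t x z (y / 2) (2 * y) ht (by positivity) hz.1.le hz.2.le p
  have h2 := h z hz p
  have h4 := (Ex_pos t x z p).le
  rw [Real.norm_eq_abs, abs_mul, abs_of_pos (Ex_pos _ _ _ _)]
  refine (mul_le_mul_of_nonneg_right h1 h4).trans ?_
  rw [mul_assoc]
  gcongr

lemma deriv_theta (t x y : ℝ) (ht : 0 < t) (hy : 0 < y) :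
    HasDerivAt (fun z => theta t x z) ((∑' p, Ac t x y p * Ex t x y p) / y ^ 2) y := by
  have h := (hasDerivAt_sumEx t x y ht hy).sub_const 1
  refine (h.congr_of_eventuallyEq ?_).congr_deriv ?_
  · filter_upwards [lt_mem_nhds hy] with z hz
    exact theta_eq t x z ht hz
  · rw [← tsum_div_const]
    exact tsum_congr fun p => by ring

lemma tsum_prod_swap (f : ℤ × ℤ → ℝ) (hf : Summable f) :
    ∑' p, f p = ∑' n : ℤ, ∑' m : ℤ, f (m, n) := by
  rw [← (Equiv.prodComm ℤ ℤ).tsum_eq f]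
  have h : Summable (fun p => f ((Equiv.prodComm ℤ ℤ) p)) := (Equiv.prodComm ℤ ℤ).summable_iff.mpr hf
  exact h.tsum_prod

lemma Ex_split (t x y : ℝ) (hy : 0 < y) (m n : ℤ) :
    Ex t x y (m, n) = Real.exp (-(t * (n : ℝ) ^ 2 * y)) *
      Real.exp (-(t / y) * ((m : ℝ) + n * x) ^ 2) := by
  unfold Ex
  rw [← Real.exp_add]
  congr 1
  field_simp
  ring

open HurwitzZeta in
lemma inner_even (t x y : ℝ) (ht : 0 < t) (hy : 0 < y) (n : ℤ) :
    ∑' m : ℤ, Ex t x y (m, n) = Real.exp (-(t * (n : ℝ) ^ 2 * y)) *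
      evenKernel ((n * x : ℝ) : UnitAddCircle) (t / (Real.pi * y)) := by
  rw [← (hasSum_int_evenKernel (n * x) (t := t / (Real.pi * y)) (by positivity)).tsum_eq,
    ← tsum_mul_left]
  refine tsum_congr fun m => ?_
  rw [Ex_split t x y hy]
  congr 2
  field_simp

open HurwitzZeta in
lemma functional_eq (t x y : ℝ) (ht : 0 < t) (hy : 0 < y) :
    ∑' p, Ex t x y p = Real.pi / t * ∑' p, Ex (Real.pi ^ 2 / t) x y p := by
  have hpi := Real.pi_pos
  have ht' : 0 < Real.pi ^ 2 / t := by positivity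
  rw [tsum_prod_swap _ (summable_Ex t x y ht hy), tsum_prod_swap _ (summable_Ex _ x y ht' hy)]
  simp_rw [inner_even t x y ht hy, inner_even _ x y ht' hy]
  set τ := t / (Real.pi * y) with hτ
  have hτ0 : 0 < τ := by positivity
  set σ := t * y / Real.pi with hσ
  have hσ0 : 0 < σ := by positivity
  have e1 : Real.pi ^ 2 / t / (Real.pi * y) = 1 / σ := by rw [hσ]; field_simp
  rw [e1]
  have e2 : ∀ k : ℤ, evenKernel ((k * x : ℝ) : UnitAddCircle) (1 / σ) =
      σ ^ (1 / 2 : ℝ) * cosKernel ((k * x : ℝ) : UnitAddCircle) σ := by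
    intro k
    rw [evenKernel_functional_equation, one_div_one_div, Real.div_rpow zero_le_one hσ0.le,
      Real.one_rpow, one_div_one_div]
  simp_rw [e2, evenKernel_functional_equation _ τ]
  have e3 : Real.pi / t * σ ^ (1 / 2 : ℝ) = 1 / τ ^ (1 / 2 : ℝ) := by
    have : Real.pi / t = (1 / (τ * σ)) ^ (1 / 2 : ℝ) := by
      have : 1 / (τ * σ) = (Real.pi / t) ^ 2 := by rw [hτ, hσ]; field_simp
      rw [this, ← Real.sqrt_eq_rpow, Real.sqrt_sq (by positivity)]
    rw [this, Real.div_rpow zero_le_one (by positivity), Real.mul_rpow hτ0.le hσ0.le, Real.one_rpow]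
    field_simp
  have e4 : Real.pi / t * ∑' k : ℤ, Real.exp (-(Real.pi ^ 2 / t * (k : ℝ) ^ 2 * y)) *
      (σ ^ (1 / 2 : ℝ) * cosKernel ((k * x : ℝ) : UnitAddCircle) σ) =
      1 / τ ^ (1 / 2 : ℝ) * ∑' k : ℤ, Real.exp (-(Real.pi ^ 2 / t * (k : ℝ) ^ 2 * y)) *
        cosKernel ((k * x : ℝ) : UnitAddCircle) σ := by
    rw [← e3, mul_assoc, ← tsum_mul_left (a := σ ^ (1 / 2 : ℝ))]
    congr 1
    exact tsum_congr fun k => by ring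
  rw [e4]
  have e5 : ∑' n : ℤ, Real.exp (-(t * (n : ℝ) ^ 2 * y)) *
      (1 / τ ^ (1 / 2 : ℝ) * cosKernel ((n * x : ℝ) : UnitAddCircle) (1 / τ)) =
      1 / τ ^ (1 / 2 : ℝ) * ∑' n : ℤ, Real.exp (-(t * (n : ℝ) ^ 2 * y)) *
        cosKernel ((n * x : ℝ) : UnitAddCircle) (1 / τ) := by
    rw [← tsum_mul_left]
    exact tsum_congr fun k => by ring
  rw [e5]
  congr 1
  rw [← Complex.ofReal_inj, Complex.ofReal_tsum, Complex.ofReal_tsum]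
  simp_rw [Complex.ofReal_mul]
  have c1 : ∀ n : ℤ, ((Real.exp (-(t * (n : ℝ) ^ 2 * y)) : ℝ) : ℂ) *
      ((cosKernel ((n * x : ℝ) : UnitAddCircle) (1 / τ) : ℝ) : ℂ) =
      ∑' k : ℤ, ((Real.exp (-(t * (n : ℝ) ^ 2 * y)) : ℝ) : ℂ) *
        (Complex.exp (2 * Real.pi * Complex.I * ((n * x : ℝ) : ℂ) * k) *
          ((Real.exp (-Real.pi * (k : ℝ) ^ 2 * (1 / τ)) : ℝ) : ℂ)) := by
    intro n
    rw [← (hasSum_int_cosKernel (n * x) (t := 1 / τ) (by positivity)).tsum_eq, ← tsum_mul_left]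
  have c2 : ∀ k : ℤ, ((Real.exp (-(Real.pi ^ 2 / t * (k : ℝ) ^ 2 * y)) : ℝ) : ℂ) *
      ((cosKernel ((k * x : ℝ) : UnitAddCircle) σ : ℝ) : ℂ) =
      ∑' n : ℤ, ((Real.exp (-(Real.pi ^ 2 / t * (k : ℝ) ^ 2 * y)) : ℝ) : ℂ) *
        (Complex.exp (2 * Real.pi * Complex.I * ((k * x : ℝ) : ℂ) * n) *
          ((Real.exp (-Real.pi * (n : ℝ) ^ 2 * σ) : ℝ) : ℂ)) := by
    intro k
    rw [← (hasSum_int_cosKernel (k * x) (t := σ) (by positivity)).tsum_eq, ← tsum_mul_left]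
  simp_rw [c1, c2]
  have key : ∀ n k : ℤ, ((Real.exp (-(t * (n : ℝ) ^ 2 * y)) : ℝ) : ℂ) *
        (Complex.exp (2 * Real.pi * Complex.I * ((n * x : ℝ) : ℂ) * k) *
          ((Real.exp (-Real.pi * (k : ℝ) ^ 2 * (1 / τ)) : ℝ) : ℂ)) =
      ((Real.exp (-(Real.pi ^ 2 / t * (k : ℝ) ^ 2 * y)) : ℝ) : ℂ) *
        (Complex.exp (2 * Real.pi * Complex.I * ((k * x : ℝ) : ℂ) * n) *
          ((Real.exp (-Real.pi * (n : ℝ) ^ 2 * σ) : ℝ) : ℂ)) := by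
    intro n k
    have a1 : -(t * (n : ℝ) ^ 2 * y) = -Real.pi * (n : ℝ) ^ 2 * σ := by rw [hσ]; field_simp
    have a2 : -Real.pi * (k : ℝ) ^ 2 * (1 / τ) = -(Real.pi ^ 2 / t * (k : ℝ) ^ 2 * y) := by
      rw [hτ]; field_simp
    have a3 : 2 * Real.pi * Complex.I * ((n * x : ℝ) : ℂ) * k =
        2 * Real.pi * Complex.I * ((k * x : ℝ) : ℂ) * n := by push_cast; ring
    rw [a1, a2, a3]
    ring
  simp_rw [← key]
  refine (Summable.tsum_comm ?_).symm
  have g1 : Summable (fun n : ℤ => Real.exp (-(t * (n : ℝ) ^ 2 * y))) := by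
    refine (summable_gauss (t * y) 0 (by positivity)).congr fun n => ?_
    congr 1; ring
  have g2 : Summable (fun k : ℤ => Real.exp (-Real.pi * (k : ℝ) ^ 2 * (1 / τ))) := by
    refine (summable_gauss (Real.pi * (1 / τ)) 0 (by positivity)).congr fun n => ?_
    congr 1; ring
  have g3 := g1.mul_of_nonneg g2 (fun _ => (Real.exp_pos _).le) (fun _ => (Real.exp_pos _).le)
  refine Summable.of_norm_bounded g3 fun p => ?_
  obtain ⟨n, k⟩ := p
  simp only [Function.uncurry]
  rw [norm_mul, norm_mul, Complex.norm_real, Complex.norm_real, Real.norm_eq_abs, Real.norm_eq_abs,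
    Real.abs_exp, Real.abs_exp]
  have : ‖Complex.exp (2 * Real.pi * Complex.I * ((n * x : ℝ) : ℂ) * k)‖ = 1 := by
    have : (2 * Real.pi * Complex.I * ((n * x : ℝ) : ℂ) * k) =
      ((2 * Real.pi * (n * x) * k : ℝ) : ℂ) * Complex.I := by push_cast; ring
    rw [this, Complex.norm_exp_ofReal_mul_I]
  rw [this, one_mul]

lemma deriv_theta_dual (t x y : ℝ) (ht : 0 < t) (hy : 0 < y) :
    deriv (fun z => theta t x z) y =
      Real.pi / t * deriv (fun z => theta (Real.pi ^ 2 / t) x z) y := by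
  have ht' : 0 < Real.pi ^ 2 / t := by positivity
  have h := (((deriv_theta (Real.pi ^ 2 / t) x y ht' hy).add_const 1).const_mul
    (Real.pi / t)).sub_const 1
  rw [(deriv_theta _ x y ht' hy).deriv]
  refine HasDerivAt.deriv (h.congr_of_eventuallyEq ?_)
  filter_upwards [lt_mem_nhds hy] with z hz
  rw [theta_eq t x z ht hz, theta_eq _ x z ht' hz, functional_eq t x z ht hz]
  ring

lemma tsum_int_pair (f : ℤ → ℝ) (hf : Summable f) :
    HasSum (fun k : ℕ => f k + f (-(k + 1 : ℤ))) (∑' m, f m) := hf.hasSum.nat_add_neg_add_one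

lemma gauss_sum_le (d v : ℝ) (hd : 0 < d) :
    ∑' m : ℤ, Real.exp (-d * ((m : ℝ) + v) ^ 2) ≤ 2 * (1 - Real.exp (-d))⁻¹ := by
  have hr : Real.exp (-d) < 1 := by rw [Real.exp_lt_one_iff]; linarith
  set F := Int.fract v with hF
  have hF0 : 0 ≤ F := Int.fract_nonneg v
  have hF1 : F < 1 := Int.fract_lt_one v
  have h1 : ∑' m : ℤ, Real.exp (-d * ((m : ℝ) + v) ^ 2) =
      ∑' m : ℤ, Real.exp (-d * ((m : ℝ) + F) ^ 2) := by
    rw [← (Equiv.addRight ⌊v⌋).tsum_eq (fun m : ℤ => Real.exp (-d * ((m : ℝ) + F) ^ 2))]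
    refine tsum_congr fun m => ?_
    simp only [Equiv.coe_addRight, Int.cast_add]
    rw [add_assoc, hF, Int.floor_add_fract]
  rw [h1]
  have h2 := tsum_int_pair _ (summable_gauss d F hd)
  have h3 := (hasSum_geometric_of_lt_one (Real.exp_pos (-d)).le hr).mul_left 2
  refine hasSum_le (fun k => ?_) h2 h3
  rw [← Real.exp_nat_mul]
  have hk : (k : ℝ) ≤ (k : ℝ) ^ 2 := by
    rcases Nat.eq_zero_or_pos k with h | h
    · simp [h]
    · have : (1 : ℝ) ≤ k := by exact_mod_cast h
      nlinarith
  have hk0 : (0 : ℝ) ≤ k := by positivity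
  have a1 : Real.exp (-d * (((k : ℤ) : ℝ) + F) ^ 2) ≤ Real.exp (k * -d) := by
    rw [Real.exp_le_exp]
    push_cast
    nlinarith [mul_nonneg hd.le (by nlinarith : 0 ≤ ((k : ℝ) + F) ^ 2 - k)]
  have a2 : Real.exp (-d * (((-(k + 1 : ℤ) : ℤ) : ℝ) + F) ^ 2) ≤ Real.exp (k * -d) := by
    rw [Real.exp_le_exp]
    push_cast
    nlinarith [mul_nonneg hd.le (by nlinarith : 0 ≤ (-((k : ℝ) + 1) + F) ^ 2 - k)]
  linarith

/-- The odd Gaussian. -/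
def hh (s v : ℝ) : ℝ := v * Real.exp (-s * v ^ 2)

/-- Its periodization. -/
def gg (s v : ℝ) : ℝ := ∑' m : ℤ, hh s ((m : ℝ) + v)

lemma hh_neg (s v : ℝ) : hh s (-v) = -hh s v := by simp [hh]

lemma hh_abs_le (s v : ℝ) (hs : 3 ≤ s) : |hh s v| ≤ Real.exp (-(s / 2) * v ^ 2) := by
  unfold hh
  rw [abs_mul, Real.abs_exp]
  have h1 : |v| ≤ Real.exp (s / 2 * v ^ 2) := by
    have h2 := Real.add_one_le_exp (s / 2 * v ^ 2)
    have h3 : |v| ≤ 1 + v ^ 2 := by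
      rw [← sq_abs v]; nlinarith [sq_nonneg (|v| - 1), sq_nonneg (|v|)]
    nlinarith [sq_nonneg v]
  calc |v| * Real.exp (-s * v ^ 2) ≤ Real.exp (s / 2 * v ^ 2) * Real.exp (-s * v ^ 2) := by gcongr
    _ = _ := by rw [← Real.exp_add]; congr 1; ring

lemma summable_hh (s v : ℝ) (hs : 3 ≤ s) : Summable (fun m : ℤ => hh s ((m : ℝ) + v)) :=
  Summable.of_norm_bounded (summable_gauss (s / 2) v (by linarith)) fun m => hh_abs_le s _ hs

def hd (s v : ℝ) : ℝ := (1 - 2 * s * v ^ 2) * Real.exp (-s * v ^ 2)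

lemma hasDerivAt_hh (s v : ℝ) : HasDerivAt (hh s) (hd s v) v := by
  have h1 : HasDerivAt (fun v : ℝ => -s * v ^ 2) (-s * (2 * v)) v := by
    simpa using ((hasDerivAt_id v).pow 2).const_mul (-s)
  refine ((hasDerivAt_id v).mul h1.exp).congr_deriv ?_
  unfold hd
  simp only [id]
  ring

lemma hd_abs_le (s v : ℝ) (hs : 3 ≤ s) : |hd s v| ≤ 2 * Real.exp (-(s / 2) * v ^ 2) := by
  unfold hd
  rw [abs_mul, Real.abs_exp]
  have h0 : 0 ≤ s / 2 * v ^ 2 := by positivity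
  have h1 : |1 - 2 * s * v ^ 2| ≤ 2 * Real.exp (s / 2 * v ^ 2) := by
    have h2 := Real.quadratic_le_exp_of_nonneg h0
    rw [abs_le]
    constructor <;> nlinarith [sq_nonneg (s / 2 * v ^ 2 - 1)]
  calc |1 - 2 * s * v ^ 2| * Real.exp (-s * v ^ 2)
      ≤ 2 * Real.exp (s / 2 * v ^ 2) * Real.exp (-s * v ^ 2) := by gcongr
    _ = _ := by rw [mul_assoc, ← Real.exp_add]; congr 2; ring

lemma hasDerivAt_gg (s v : ℝ) (hs : 3 ≤ s) :
    HasDerivAt (gg s) (∑' m : ℤ, hd s ((m : ℝ) + v)) v := by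
  have hmem : v ∈ Set.Ioo (v - 1) (v + 1) := ⟨by linarith, by linarith⟩
  refine hasDerivAt_tsum_of_isPreconnected (g := fun (m : ℤ) z => hh s ((m : ℝ) + z))
    (g' := fun (m : ℤ) z => hd s ((m : ℝ) + z)) (u := fun m : ℤ => 2 * Real.exp (s / 2) * Real.exp (-(s / 4) * ((m : ℝ) + v) ^ 2))
    ((summable_gauss (s / 4) v (by linarith)).mul_left _) isOpen_Ioo isPreconnected_Ioo
    (fun m z hz => ?_) (fun m z hz => ?_) hmem (summable_hh s v hs) hmem
  · exact (hasDerivAt_hh s ((m : ℝ) + z)).comp_const_add (m : ℝ) z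
  · refine (hd_abs_le s _ hs).trans ?_
    rw [mul_assoc, ← Real.exp_add]
    gcongr
    have h1 : (z - v) ^ 2 ≤ 1 := by nlinarith [hz.1, hz.2]
    have h2 : ((m : ℝ) + v) ^ 2 ≤ 2 * ((m : ℝ) + z) ^ 2 + 2 * (z - v) ^ 2 := by
      nlinarith [sq_nonneg (((m : ℝ) + z) + (z - v))]
    have h3 : ((m : ℝ) + v) ^ 2 ≤ 2 * ((m : ℝ) + z) ^ 2 + 2 := by linarith
    have h4 := mul_le_mul_of_nonneg_left h3 (by linarith : 0 ≤ s / 4)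
    linarith

lemma exp_neg_three_halves : Real.exp (-(3 / 2)) ≤ 1 / 4 := by
  rw [Real.exp_neg, one_div]
  apply inv_anti₀ (by norm_num)
  have h := Real.quadratic_le_exp_of_nonneg (x := 3 / 2) (by norm_num)
  have h1 := Real.exp_one_gt_d9
  have h2 : Real.exp (3 / 2) = Real.exp 1 * Real.exp (1 / 2) := by
    rw [← Real.exp_add]; norm_num
  have h3 := Real.quadratic_le_exp_of_nonneg (x := 1 / 2) (by norm_num)
  rw [h2]
  nlinarith

lemma gg_lip (s u v : ℝ) (hs : 3 ≤ s) : |gg s u - gg s v| ≤ 6 * |u - v| := by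
  have h := Convex.norm_image_sub_le_of_norm_hasDerivWithin_le (f := gg s) (s := Set.univ)
    (f' := fun w => ∑' m : ℤ, hd s ((m : ℝ) + w)) (C := 6)
    (fun w _ => (hasDerivAt_gg s w hs).hasDerivWithinAt) (fun w _ => ?_) convex_univ
    (Set.mem_univ v) (Set.mem_univ u)
  · simpa using h
  · have g := summable_gauss (s / 2) w (by linarith)
    have h1 : Summable (fun m : ℤ => ‖hd s ((m : ℝ) + w)‖) :=
      Summable.of_nonneg_of_le (fun _ => norm_nonneg _) (fun m => hd_abs_le s _ hs) (g.mul_left 2)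
    refine (norm_tsum_le_tsum_norm h1).trans ?_
    refine (h1.tsum_le_tsum (fun m => hd_abs_le s _ hs) (g.mul_left 2)).trans ?_
    rw [tsum_mul_left]
    have h2 := gauss_sum_le (s / 2) w (by linarith)
    have h3 : Real.exp (-(s / 2)) ≤ 1 / 4 := by
      refine le_trans ?_ exp_neg_three_halves
      rw [Real.exp_le_exp]; linarith
    have h4 : (1 - Real.exp (-(s / 2)))⁻¹ ≤ (3 / 4)⁻¹ := inv_anti₀ (by norm_num) (by linarith)
    norm_num at h4
    linarith

lemma gg_half (s : ℝ) (n : ℤ) : gg s ((n : ℝ) / 2) = 0 := by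
  have h : gg s ((n : ℝ) / 2) = -gg s ((n : ℝ) / 2) := by
    conv_lhs => unfold gg
    rw [← (Equiv.subLeft (-n)).tsum_eq]
    unfold gg
    rw [← tsum_neg]
    refine tsum_congr fun m => ?_
    rw [← hh_neg]
    congr 1
    simp only [Equiv.subLeft_apply]
    push_cast
    ring
  linarith

lemma gg_upper (s x : ℝ) (hs : 3 ≤ s) (hx0 : 0 ≤ x) (hx1 : x ≤ 1 / 2) (n : ℕ) :
    |gg s (n * x)| ≤ 6 * n * min x (1 / 2 - x) := by
  have h1 := gg_lip s (n * x) 0 hs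
  have h2 := gg_lip s (n * x) ((n : ℤ) / 2 : ℝ) hs
  have h3 := gg_half s 0
  simp only [Int.cast_zero, zero_div] at h3
  rw [h3, sub_zero, sub_zero, abs_of_nonneg (by positivity : 0 ≤ n * x)] at h1
  rw [gg_half, sub_zero] at h2
  have hn : (0 : ℝ) ≤ n := by positivity
  have h4 : |n * x - ((n : ℤ) / 2 : ℝ)| = n * (1 / 2 - x) := by
    push_cast
    rw [abs_of_nonpos (by nlinarith)]; ring
  rw [h4] at h2
  rcases min_cases x (1 / 2 - x) with ⟨h, _⟩ | ⟨h, _⟩ <;> rw [h] <;> linarith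

lemma hh_anti (s u v : ℝ) (hs : 3 ≤ s) (hu : 1 ≤ u) (huv : u ≤ v) : hh s v ≤ hh s u := by
  have h : AntitoneOn (hh s) (Set.Ici 1) := by
    refine antitoneOn_of_deriv_nonpos (convex_Ici 1)
      (fun w _ => (hasDerivAt_hh s w).continuousAt.continuousWithinAt)
      (fun w _ => (hasDerivAt_hh s w).differentiableAt.differentiableWithinAt) (fun w hw => ?_)
    rw [interior_Ici] at hw
    rw [(hasDerivAt_hh s w).deriv]
    have hw1 : (1 : ℝ) < w := hw
    unfold hd
    have : 1 - 2 * s * w ^ 2 ≤ 0 := by nlinarith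
    exact mul_nonpos_of_nonpos_of_nonneg this (Real.exp_pos _).le
  exact h hu (hu.trans huv) huv

lemma gg_lower1 (s x : ℝ) (hs : 3 ≤ s) (hx0 : 1 / 5 ≤ x) (hx1 : x ≤ 1 / 2) :
    0.1 * Real.exp (-(s / 4)) * (1 / 2 - x) ≤ gg s x := by
  have h1 := tsum_int_pair _ (summable_hh s x hs)
  have hpair : ∀ k : ℕ, hh s (((k : ℤ) : ℝ) + x) + hh s (((-(k + 1 : ℤ) : ℤ) : ℝ) + x) =
      hh s ((k : ℝ) + x) - hh s ((k : ℝ) + (1 - x)) := by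
    intro k
    have : (((-(k + 1 : ℤ) : ℤ) : ℝ) + x) = -((k : ℝ) + (1 - x)) := by push_cast; ring
    rw [this, hh_neg]; push_cast; ring
  simp_rw [hpair] at h1
  have h2 : hh s (((0 : ℕ) : ℝ) + x) - hh s (((0 : ℕ) : ℝ) + (1 - x)) ≤ gg s x := by
    refine le_hasSum h1 0 fun k hk => ?_
    have : (1 : ℝ) ≤ k := by exact_mod_cast Nat.one_le_iff_ne_zero.mpr hk
    have := hh_anti s ((k : ℝ) + x) ((k : ℝ) + (1 - x)) hs (by linarith) (by linarith)
    linarith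
  refine le_trans ?_ h2
  simp only [Nat.cast_zero, zero_add]
  unfold hh
  set w := 1 - 2 * x with hw
  have hw0 : 0 ≤ w := by linarith
  have hw1 : w ≤ 3 / 5 := by linarith
  have e1 : Real.exp (-s * (1 - x) ^ 2) = Real.exp (-s * x ^ 2) * Real.exp (-(s * w)) := by
    rw [← Real.exp_add]; congr 1; rw [hw]; ring
  have e2 : Real.exp (-(s * w)) * (1 + 3 * w + 9 / 2 * w ^ 2 + 9 / 2 * w ^ 3) ≤ 1 := by
    have h3 := Real.sum_le_exp_of_nonneg (x := 3 * w) (by linarith) 4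
    simp [Finset.sum_range_succ, Nat.factorial] at h3
    have h4 : Real.exp (3 * w) ≤ Real.exp (s * w) := by
      rw [Real.exp_le_exp]; nlinarith
    rw [Real.exp_neg, inv_mul_le_iff₀ (Real.exp_pos _)]
    nlinarith
  set q := Real.exp (-(s * w)) with hq
  have hq0 : 0 < q := Real.exp_pos _
  have e3 : Real.exp (-(s / 4)) ≤ Real.exp (-s * x ^ 2) := by
    have : x ^ 2 ≤ 1 / 4 := by nlinarith
    rw [Real.exp_le_exp]; nlinarith
  have e4 : 0.1 * (1 / 2 - x) ≤ x - (1 - x) * q := by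
    have hD : 0 < 1 + 3 * w + 9 / 2 * w ^ 2 + 9 / 2 * w ^ 3 := by positivity
    have hxw : x = (1 - w) / 2 := by rw [hw]; ring
    have h5 : (1 - x) * q * (1 + 3 * w + 9 / 2 * w ^ 2 + 9 / 2 * w ^ 3) ≤ 1 - x := by nlinarith
    have h6 : 0.1 * (1 / 2 - x) * (1 + 3 * w + 9 / 2 * w ^ 2 + 9 / 2 * w ^ 3) ≤
        x * (1 + 3 * w + 9 / 2 * w ^ 2 + 9 / 2 * w ^ 3) - (1 - x) := by
      have h7 : 0 ≤ w * (0.9 + 1.2 * w - 0.45 * w ^ 2 - 4.95 * w ^ 3) := by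
        apply mul_nonneg hw0
        have h8 : w ^ 2 ≤ 9 / 25 := by nlinarith
        have h9 : w ^ 3 ≤ 27 / 125 := by
          have := pow_le_pow_left₀ hw0 hw1 3
          norm_num at this; linarith
        have h10 : w ^ 3 ≤ 9 / 25 * w := by nlinarith
        nlinarith
      have h11 : x * (1 + 3 * w + 9 / 2 * w ^ 2 + 9 / 2 * w ^ 3) - (1 - x) -
          0.1 * (1 / 2 - x) * (1 + 3 * w + 9 / 2 * w ^ 2 + 9 / 2 * w ^ 3) =
          w * (0.9 + 1.2 * w - 0.45 * w ^ 2 - 4.95 * w ^ 3) / 2 := by rw [hxw]; ring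
      linarith
    by_contra hc
    push Not at hc
    nlinarith
  have e5 : 0 ≤ 0.1 * (1 / 2 - x) := by linarith
  rw [e1]
  calc 0.1 * Real.exp (-(s / 4)) * (1 / 2 - x) = Real.exp (-(s / 4)) * (0.1 * (1 / 2 - x)) := by ring
    _ ≤ Real.exp (-s * x ^ 2) * (x - (1 - x) * q) := by gcongr
    _ = _ := by ring

lemma sinh_scale (l a : ℝ) (hl0 : 0 ≤ l) (hl1 : l ≤ 1) (ha : 0 ≤ a) :
    Real.sinh (l * a) ≤ l * Real.sinh a := by
  have h : ConvexOn ℝ (Set.Ici 0) Real.sinh := by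
    refine convexOn_of_deriv2_nonneg (convex_Ici 0) Real.continuous_sinh.continuousOn
      Real.differentiable_sinh.differentiableOn (by simpa using Real.differentiable_cosh.differentiableOn) ?_
    intro x hx
    rw [interior_Ici] at hx
    simp only [Function.iterate_succ, Function.iterate_zero, Function.comp_apply, id,
      Real.deriv_sinh, Real.deriv_cosh]
    exact (Real.sinh_pos_iff.mpr hx).le
  have := h.2 (Set.mem_Ici.mpr ha) (Set.mem_Ici.mpr le_rfl) hl0 (by linarith : 0 ≤ 1 - l) (by ring)
  simpa using this

lemma exp_bound_a (s : ℝ) (hs : 3 ≤ s) : Real.exp (-(0.6 * s)) ≤ 1 / 6 := by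
  have h1 : Real.exp (-(0.6 * s)) ≤ Real.exp (-(9 / 5)) := by
    rw [Real.exp_le_exp]; linarith
  refine h1.trans ?_
  rw [Real.exp_neg, one_div]
  apply inv_anti₀ (by norm_num)
  by_contra hc
  push Not at hc
  have h2 : Real.exp (9 / 5) ^ 5 = Real.exp 1 ^ 9 := by
    rw [← Real.exp_nat_mul, ← Real.exp_nat_mul]; norm_num
  have h3 : Real.exp (9 / 5) ^ 5 < 6 ^ 5 := pow_lt_pow_left₀ hc (Real.exp_pos _).le (by norm_num)
  have h4 : (2.718 : ℝ) ^ 9 ≤ Real.exp 1 ^ 9 :=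
    pow_le_pow_left₀ (by norm_num) (by linarith [Real.exp_one_gt_d9]) 9
  rw [h2] at h3
  have h5 := h4.trans_lt h3
  norm_num at h5

lemma exp_bound_b (s : ℝ) (hs : 3 ≤ s) : Real.exp (-(1.6 * s)) ≤ 1 / 60 := by
  have h1 : Real.exp (-(1.6 * s)) = Real.exp (-(0.6 * s)) * Real.exp (-s) := by
    rw [← Real.exp_add]; congr 1; ring
  have h2 : Real.exp (-s) ≤ 1 / 10 := by
    have : Real.exp (-s) ≤ Real.exp (-(3 / 2)) * Real.exp (-(3 / 2)) := by
      rw [← Real.exp_add, Real.exp_le_exp]; linarith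
    nlinarith [exp_neg_three_halves, Real.exp_pos (-(3 / 2))]
  rw [h1]
  have := exp_bound_a s hs
  calc _ ≤ (1 / 6 : ℝ) * (1 / 10) := by gcongr
    _ = _ := by norm_num

lemma gg_lower2 (s x : ℝ) (hs : 3 ≤ s) (hx0 : 0 ≤ x) (hx1 : x ≤ 1 / 5) :
    0.1 * Real.exp (-(s / 4)) * x ≤ gg s x := by
  have h1 := (summable_hh s x hs).hasSum.nat_add_neg
  rw [← hasSum_nat_add_iff' 1] at h1
  simp only [Finset.sum_range_one] at h1
  have h2 : (∑' m : ℤ, hh s ((m : ℝ) + x)) + hh s (((0 : ℤ) : ℝ) + x) -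
      (hh s ((((0 : ℕ) : ℤ) : ℝ) + x) + hh s (((-((0 : ℕ) : ℤ) : ℤ) : ℝ) + x)) = gg s x - hh s x := by
    unfold gg; simp
  rw [h2] at h1
  set r := Real.exp (-(1.6 * s)) with hr
  have hr0 : 0 < r := Real.exp_pos _
  have hrb : r ≤ 1 / 60 := exp_bound_b s hs
  have h3 := (hasSum_geometric_of_lt_one (r := 2 * r) (by positivity) (by linarith)).mul_left
    (-(5 * x * Real.exp (-s * x ^ 2) * Real.exp (-(0.6 * s))))
  have h4 := hasSum_le (fun k => ?_) h3 h1
  · have e1 := exp_bound_a s hs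
    set q := Real.exp (-(0.6 * s))
    have hq0 : 0 < q := Real.exp_pos _
    have e2 : (1 - 2 * r)⁻¹ ≤ (29 / 30)⁻¹ := inv_anti₀ (by norm_num) (by linarith)
    have e2' : 0 < (1 - 2 * r)⁻¹ := inv_pos.mpr (by linarith)
    norm_num at e2
    have e3 : q * (1 - 2 * r)⁻¹ ≤ 1 / 6 * (30 / 29) := by gcongr
    have e4 : Real.exp (-(s / 4)) ≤ Real.exp (-s * x ^ 2) := by
      have : x ^ 2 ≤ 1 / 4 := by nlinarith
      rw [Real.exp_le_exp]; nlinarith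
    set Q := Real.exp (-s * x ^ 2) with hQ
    have hQ0 : 0 < Q := Real.exp_pos _
    have e5 : hh s x = x * Q := rfl
    rw [e5] at h4
    have e6 : x * Q * (q * (1 - 2 * r)⁻¹) ≤ x * Q * (1 / 6 * (30 / 29)) := by gcongr
    have e7 : x * Real.exp (-(s / 4)) ≤ x * Q := by gcongr
    have e8 : 0 ≤ x * Q := by positivity
    linarith
  · set K : ℝ := (k : ℝ) + 1 with hK
    have hK1 : 1 ≤ K := by rw [hK]; linarith [(Nat.cast_nonneg k : (0 : ℝ) ≤ k)]
    have a1 : ((((k + 1 : ℕ) : ℤ) : ℝ) + x) = K + x := by push_cast; ring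
    have a2 : (((-((k + 1 : ℕ) : ℤ) : ℤ) : ℝ) + x) = -(K - x) := by push_cast; ring
    rw [a1, a2, hh_neg]
    unfold hh
    set z := 2 * s * K * x with hz
    have b1 : Real.exp (-s * (K + x) ^ 2) = Real.exp (-s * K ^ 2) * Real.exp (-s * x ^ 2) * Real.exp (-z) := by
      rw [← Real.exp_add, ← Real.exp_add]; congr 1; rw [hz]; ring
    have b2 : Real.exp (-s * (K - x) ^ 2) = Real.exp (-s * K ^ 2) * Real.exp (-s * x ^ 2) * Real.exp z := by
      rw [← Real.exp_add, ← Real.exp_add]; congr 1; rw [hz]; ring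
    rw [b1, b2]
    have b3 := sinh_scale (5 * x) (0.4 * s * K) (by linarith) (by linarith) (by positivity)
    have b4 : 5 * x * (0.4 * s * K) = z := by rw [hz]; ring
    rw [b4, Real.sinh_eq, Real.sinh_eq] at b3
    have b5 : Real.exp z - Real.exp (-z) ≤ 5 * x * Real.exp (0.4 * s * K) := by
      have := mul_nonneg hx0 (Real.exp_pos (-(0.4 * s * K))).le
      linarith
    have b6 : Real.exp (-s * K ^ 2) * Real.exp (0.4 * s * K) ≤ Real.exp (-(0.6 * s)) * r ^ k := by
      rw [hr, ← Real.exp_nat_mul, ← Real.exp_add, ← Real.exp_add, Real.exp_le_exp]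
      have : (k : ℝ) = K - 1 := by rw [hK]; ring
      rw [this]
      nlinarith [mul_nonneg (by linarith : 0 ≤ s) (mul_nonneg (by linarith : 0 ≤ K - 1) (by linarith : 0 ≤ K - 1))]
    have b7 : K ≤ 2 ^ k := by
      have := Nat.lt_two_pow_self (n := k)
      rw [hK]; exact_mod_cast this
    have p1 := Real.exp_pos (-s * K ^ 2)
    have p2 := Real.exp_pos (-s * x ^ 2)
    have p3 := Real.exp_pos z
    have p4 := Real.exp_pos (-z)
    have p5 : 0 < r ^ k := by positivity
    have p6 := Real.exp_pos (-(0.6 * s))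
    set A := Real.exp (-s * K ^ 2)
    set Q := Real.exp (-s * x ^ 2)
    set q := Real.exp (-(0.6 * s))
    rw [mul_pow]
    have c1 : (K + x) * (A * Q * Real.exp (-z)) + -((K - x) * (A * Q * Real.exp z)) =
        A * Q * (x * (Real.exp z + Real.exp (-z))) - A * Q * K * (Real.exp z - Real.exp (-z)) := by ring
    rw [c1]
    have c2 : 0 ≤ A * Q * (x * (Real.exp z + Real.exp (-z))) := by positivity
    have c3 : A * Q * K * (Real.exp z - Real.exp (-z)) ≤ 5 * x * Q * K * (q * r ^ k) := by
      calc A * Q * K * (Real.exp z - Real.exp (-z)) ≤ A * Q * K * (5 * x * Real.exp (0.4 * s * K)) := by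
            gcongr
        _ = 5 * x * Q * K * (A * Real.exp (0.4 * s * K)) := by ring
        _ ≤ _ := by gcongr
    have c4 : 5 * x * Q * K * (q * r ^ k) ≤ 5 * x * Q * 2 ^ k * (q * r ^ k) := by gcongr
    linarith

lemma gg_lower (s x : ℝ) (hs : 3 ≤ s) (hx0 : 0 ≤ x) (hx1 : x ≤ 1 / 2) :
    0.1 * Real.exp (-(s / 4)) * min x (1 / 2 - x) ≤ gg s x := by
  have hp := Real.exp_pos (-(s / 4))
  rcases le_total x (1 / 5) with h | h
  · exact le_trans (by gcongr; exact min_le_left _ _) (gg_lower2 s x hs hx0 h)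
  · exact le_trans (by gcongr; exact min_le_right _ _) (gg_lower1 s x hs h hx1)

/-- The term of the series for `-∂_x θ` (up to a positive factor). -/
def Sc (x : ℝ) (p : ℤ × ℤ) : ℝ := (p.2 : ℝ) * ((p.1 : ℝ) + (p.2 : ℝ) * x)

lemma summable_Sc (t x y : ℝ) (ht : 0 < t) (hy : 0 < y) :
    Summable (fun p => Sc x p * Ex t x y p) := by
  refine summable_poly t x y ht hy _ (1 + |x|) fun p => ?_
  have h3 := le_sq_of_one ((p.1 : ℝ) ^ 2 + (p.2 : ℝ) ^ 2) (by positivity)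
  rw [← add_assoc] at h3
  have h1 : |Sc x p| ≤ (1 + |x|) * (1 + (p.1 : ℝ) ^ 2 + (p.2 : ℝ) ^ 2) := by
    unfold Sc
    have e : (p.2 : ℝ) * ((p.1 : ℝ) + (p.2 : ℝ) * x) = (p.2 : ℝ) * p.1 + (p.2 : ℝ) ^ 2 * x := by ring
    rw [e]
    refine (abs_add_le _ _).trans ?_
    rw [abs_mul ((p.2 : ℝ) ^ 2), abs_of_nonneg (sq_nonneg (p.2 : ℝ))]
    have h4 : |(p.2 : ℝ) * p.1| ≤ (p.1 : ℝ) ^ 2 + (p.2 : ℝ) ^ 2 := by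
      rw [abs_le]
      constructor <;> nlinarith [sq_nonneg ((p.1 : ℝ) - p.2), sq_nonneg ((p.1 : ℝ) + p.2)]
    nlinarith [abs_nonneg x, mul_nonneg (abs_nonneg x) (sq_nonneg (p.1 : ℝ)),
      mul_nonneg (abs_nonneg x) (sq_nonneg (p.2 : ℝ))]
  exact h1.trans (by gcongr)

lemma inner_Sc (t x y : ℝ) (hy : 0 < y) (n : ℤ) :
    ∑' m : ℤ, Sc x (m, n) * Ex t x y (m, n) =
      n * Real.exp (-(t * (n : ℝ) ^ 2 * y)) * gg (t / y) (n * x) := by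
  unfold gg
  rw [← tsum_mul_left]
  refine tsum_congr fun m => ?_
  rw [Ex_split t x y hy]
  unfold Sc hh
  ring

lemma summable_inner (f : ℤ × ℤ → ℝ) (hf : Summable f) : Summable (fun n : ℤ => ∑' m : ℤ, f (m, n)) := by
  have h : Summable (fun p => f ((Equiv.prodComm ℤ ℤ) p)) := (Equiv.prodComm ℤ ℤ).summable_iff.mpr hf
  exact h.prod

lemma gg_neg (s v : ℝ) : gg s (-v) = -gg s v := by
  unfold gg
  rw [← (Equiv.neg ℤ).tsum_eq, ← tsum_neg]
  refine tsum_congr fun m => ?_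
  rw [← hh_neg]
  congr 1
  simp only [Equiv.neg_apply]
  push_cast
  ring

lemma S_half (t y : ℝ) (ht : 0 < t) (hy : 0 < y) :
    ∑' p, Sc (1 / 2) p * Ex t (1 / 2) y p = 0 := by
  rw [tsum_prod_swap _ (summable_Sc t _ y ht hy)]
  simp_rw [inner_Sc t (1 / 2) y hy]
  have : ∀ n : ℤ, gg (t / y) ((n : ℝ) * (1 / 2)) = 0 := by
    intro n
    rw [mul_one_div]; exact gg_half _ n
  simp only [this, mul_zero, tsum_zero]

lemma exp_neg_three : Real.exp (-3) ≤ 1 / 20 := by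
  rw [Real.exp_neg, one_div]
  apply inv_anti₀ (by norm_num)
  have h : Real.exp 3 = Real.exp 1 ^ 3 := by rw [← Real.exp_nat_mul]; norm_num
  have h4 : (2.718 : ℝ) ^ 3 ≤ Real.exp 1 ^ 3 :=
    pow_le_pow_left₀ (by norm_num) (by linarith [Real.exp_one_gt_d9]) 3
  rw [h]
  refine le_trans ?_ h4
  norm_num

lemma sq_le_geom (k : ℕ) : ((k : ℝ) + 2) ^ 2 ≤ 4 * (9 / 4) ^ k := by
  induction k with
  | zero => norm_num
  | succ j ih =>
    have : (0 : ℝ) ≤ j := by positivity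
    rw [pow_succ (9/4 : ℝ) j]
    push_cast
    nlinarith

lemma S_pos (t x y : ℝ) (ht : 3 ≤ t) (hx0 : 0 < x) (hx1 : x < 1 / 2) (hy0 : 0 < y)
    (hy1 : y ≤ 1) (hy34 : 3 / 4 ≤ y ^ 2) :
    0 < ∑' p, Sc x p * Ex t x y p := by
  have ht0 : 0 < t := by linarith
  have hs : 3 ≤ t / y := by rw [le_div_iff₀ hy0]; nlinarith
  have hy86 : 3 / 4 ≤ y := by nlinarith
  rw [tsum_prod_swap _ (summable_Sc t _ y ht0 hy0)]
  have hsum := summable_inner _ (summable_Sc t x y ht0 hy0)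
  simp_rw [inner_Sc t x y hy0] at hsum ⊢
  set f : ℤ → ℝ := fun n => n * Real.exp (-(t * (n : ℝ) ^ 2 * y)) * gg (t / y) (n * x) with hf
  have h1 := hsum.hasSum.nat_add_neg
  have hf0 : f 0 = 0 := by simp [hf]
  have hfn : ∀ n : ℤ, f (-n) = f n := by
    intro n
    simp only [hf]
    push_cast
    rw [neg_mul (n : ℝ) x, gg_neg]
    ring_nf
  have h1' : HasSum (fun k : ℕ => 2 * f k) (∑' n, f n) := by
    have e : (fun k : ℕ => 2 * f k) = (fun k : ℕ => f k + f (-(k : ℤ))) := by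
      funext k; rw [hfn]; ring
    rw [e]
    have h2 := h1
    simp only [hf0, add_zero] at h2
    exact h2
  rw [← hasSum_nat_add_iff' 2] at h1'
  simp only [Finset.sum_range_succ, Finset.sum_range_zero, zero_add] at h1'
  set μ := min x (1 / 2 - x) with hμ
  have hμ0 : 0 < μ := lt_min hx0 (by linarith)
  set U := Real.exp (-(t * y)) * Real.exp (-(t / y / 4)) with hU
  have hU0 : 0 < U := by positivity
  have e3 := exp_neg_three
  have e30 := Real.exp_pos (-3)
  set q := Real.exp (-3) with hq
  have hgeo := (hasSum_geometric_of_lt_one (r := 9 / 4 * q) (by positivity) (by linarith)).mul_left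
    (-(48 * μ * U * q ^ 2))
  have hle := hasSum_le (fun k => ?_) hgeo h1'
  · have hb := gg_lower (t / y) x hs hx0.le hx1.le
    have hf1 : 0.1 * μ * U ≤ f 1 := by
      simp only [hf, Int.cast_one, one_mul, one_pow, mul_one]
      have := Real.exp_pos (-(t * y))
      calc 0.1 * μ * U = Real.exp (-(t * y)) * (0.1 * Real.exp (-(t / y / 4)) * μ) := by rw [hU]; ring
        _ ≤ _ := by gcongr
    have hi : (1 - 9 / 4 * q)⁻¹ ≤ (71 / 80)⁻¹ := inv_anti₀ (by norm_num) (by linarith)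
    norm_num at hi
    have hq2 : q ^ 2 ≤ 1 / 400 := by nlinarith
    have hi0 : 0 < (1 - 9 / 4 * q)⁻¹ := inv_pos.mpr (by linarith)
    have hk : q ^ 2 * (1 - 9 / 4 * q)⁻¹ ≤ 1 / 400 * (80 / 71) := by gcongr
    have hk2 : μ * U * (q ^ 2 * (1 - 9 / 4 * q)⁻¹) ≤ μ * U * (1 / 400 * (80 / 71)) := by gcongr
    have hmu : 0 < μ * U := by positivity
    simp only [Nat.cast_zero, hf0, Nat.cast_one, mul_zero, zero_add] at hle
    linarith
  · set n : ℝ := (k : ℝ) + 2 with hn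
    have hn2 : 2 ≤ n := by rw [hn]; linarith [(Nat.cast_nonneg k : (0 : ℝ) ≤ k)]
    have hup := gg_upper (t / y) x hs hx0.le hx1.le (k + 2)
    have hc : ((k + 2 : ℕ) : ℝ) = n := by push_cast; rfl
    have hc' : (((k + 2 : ℕ) : ℤ) : ℝ) = n := by push_cast; rfl
    rw [hc] at hup
    simp only [hf]
    rw [hc']
    have hexp : Real.exp (-(t * n ^ 2 * y)) ≤ U * (q ^ 2 * q ^ k) := by
      rw [hU, hq, ← Real.exp_nat_mul, ← Real.exp_nat_mul, ← Real.exp_add, ← Real.exp_add,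
        ← Real.exp_add, Real.exp_le_exp]
      have hk : (k : ℝ) = n - 2 := by rw [hn]; ring
      rw [hk]
      have h14 : t / y / 4 ≤ t * y / 3 := by
        rw [div_div, div_le_div_iff₀ (by positivity) (by norm_num)]
        nlinarith
      have hty : 9 / 4 ≤ t * y := by nlinarith
      have hn3 : 4 / 3 * n ≤ n ^ 2 - 4 / 3 := by nlinarith
      have h5 := mul_le_mul hty hn3 (by linarith) (by linarith)
      push_cast
      nlinarith
    have h6 : |gg (t / y) (n * x)| ≤ 6 * n * μ := hup
    have h7 := (abs_le.mp h6).1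
    have hsq := sq_le_geom k
    have hp := Real.exp_pos (-(t * n ^ 2 * y))
    have h8 : 2 * (n * Real.exp (-(t * n ^ 2 * y)) * gg (t / y) (n * x)) ≥
        2 * (n * Real.exp (-(t * n ^ 2 * y)) * (-(6 * n * μ))) := by gcongr
    have h9 : 12 * μ * n ^ 2 * Real.exp (-(t * n ^ 2 * y)) ≤
        12 * μ * (4 * (9 / 4) ^ k) * (U * (q ^ 2 * q ^ k)) := by gcongr
    rw [mul_pow]
    linarith

lemma A_arc (t x y : ℝ) (ht : 0 < t) (hy : 0 < y) (hxy : x ^ 2 + y ^ 2 = 1) :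
    ∑' p, Ac t x y p * Ex t x y p = 2 * x * t * ∑' p, Sc x p * Ex t x y p := by
  have hsym : ∀ p : ℤ × ℤ, Ex t x y p.swap = Ex t x y p := by
    intro p
    unfold Ex
    congr 1
    simp only [Prod.fst_swap, Prod.snd_swap]
    have : y ^ 2 = 1 - x ^ 2 := by linarith
    rw [this]
    ring
  have hD : ∑' p : ℤ × ℤ, ((p.1 : ℝ) ^ 2 - (p.2 : ℝ) ^ 2) * Ex t x y p = 0 := by
    have h : ∑' p : ℤ × ℤ, ((p.1 : ℝ) ^ 2 - (p.2 : ℝ) ^ 2) * Ex t x y p =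
        -∑' p : ℤ × ℤ, ((p.1 : ℝ) ^ 2 - (p.2 : ℝ) ^ 2) * Ex t x y p := by
      rw [← tsum_neg]
      conv_lhs => rw [← (Equiv.prodComm ℤ ℤ).tsum_eq]
      refine tsum_congr fun p => ?_
      rw [Equiv.prodComm_apply, hsym]
      simp only [Prod.fst_swap, Prod.snd_swap]
      ring
    linarith
  have hDs : Summable (fun p : ℤ × ℤ => ((p.1 : ℝ) ^ 2 - (p.2 : ℝ) ^ 2) * Ex t x y p) := by
    refine summable_poly t x y ht hy _ 1 fun p => ?_
    have h3 := le_sq_of_one ((p.1 : ℝ) ^ 2 + (p.2 : ℝ) ^ 2) (by positivity)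
    rw [← add_assoc] at h3
    rw [one_mul, abs_le]
    constructor <;> nlinarith [sq_nonneg (p.1 : ℝ), sq_nonneg (p.2 : ℝ)]
  have hS := summable_Sc t x y ht hy
  calc ∑' p, Ac t x y p * Ex t x y p
      = ∑' p : ℤ × ℤ, (t * (((p.1 : ℝ) ^ 2 - (p.2 : ℝ) ^ 2) * Ex t x y p) +
          2 * x * t * (Sc x p * Ex t x y p)) := by
        refine tsum_congr fun p => ?_
        unfold Ac Sc
        have : y ^ 2 = 1 - x ^ 2 := by linarith
        rw [this]; ring
    _ = _ := by
        rw [(hDs.mul_left t).tsum_add (hS.mul_left (2 * x * t)), tsum_mul_left, tsum_mul_left, hD]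
        ring

/-- The (normalized) term of the series for the second derivative. -/
def bb (t x y : ℝ) (n m : ℤ) : ℝ :=
  (t * (((m : ℝ) + n * x) ^ 2 - (n : ℝ) ^ 2 * y ^ 2) ^ 2 - 2 * (n : ℝ) ^ 2 * y ^ 3) * Ex t x y (m, n)

lemma Bc_eq (t x y : ℝ) (hy : 0 < y) (p : ℤ × ℤ) :
    Bc t x y p * Ex t x y p = t / y ^ 2 * bb t x y p.2 p.1 := by
  unfold Bc bb
  field_simp

lemma summable_bb (t x y : ℝ) (ht : 0 < t) (hy : 0 < y) :
    Summable (fun p : ℤ × ℤ => bb t x y p.2 p.1) := by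
  have h := (summable_Bc t x y ht hy).mul_left (y ^ 2 / t)
  refine h.congr fun p => ?_
  rw [Bc_eq t x y hy]
  field_simp

lemma summable_bb_row (t x y : ℝ) (ht : 0 < t) (hy : 0 < y) (n : ℤ) :
    Summable (bb t x y n) := by
  have h := (summable_bb t x y ht hy).comp_injective (i := fun m : ℤ => (m, n))
    (fun a b hab => (Prod.mk.inj hab).1)
  exact h

lemma bb_neg (t x y : ℝ) (n m : ℤ) : bb t x y (-n) (-m) = bb t x y n m := by
  unfold bb Ex
  push_cast
  have e : (-(m : ℝ) + -(n : ℝ) * x) ^ 2 = ((m : ℝ) + n * x) ^ 2 := by ring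
  simp only [e, neg_sq]

lemma bb_ge (t x y : ℝ) (ht : 0 < t) (n m : ℤ) :
    -(2 * (n : ℝ) ^ 2 * y ^ 3 * Ex t x y (m, n)) ≤ bb t x y n m := by
  unfold bb
  have h := Ex_pos t x y (m, n)
  have : 0 ≤ t * (((m : ℝ) + n * x) ^ 2 - (n : ℝ) ^ 2 * y ^ 2) ^ 2 * Ex t x y (m, n) := by positivity
  linarith

lemma geom_inv (c d y : ℝ) (hc : 0 < c) (hy : 0 < y) (hd : c / y ≤ d) :
    (1 - Real.exp (-d))⁻¹ ≤ Real.exp (y / c) := by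
  have hd0 : 0 < d := lt_of_lt_of_le (by positivity) hd
  have h1 : Real.exp (-d) ≤ (1 + d)⁻¹ := by
    rw [Real.exp_neg]
    exact inv_anti₀ (by linarith) (by linarith [Real.add_one_le_exp d])
  have h2 : d / (1 + d) ≤ 1 - Real.exp (-d) := by
    have : d / (1 + d) = 1 - (1 + d)⁻¹ := by field_simp; ring
    linarith
  have h3 : (1 - Real.exp (-d))⁻¹ ≤ (d / (1 + d))⁻¹ := inv_anti₀ (by positivity) h2
  have h4 : (d / (1 + d))⁻¹ = 1 + 1 / d := by field_simp; ring
  have h5 : 1 / d ≤ y / c := by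
    rw [div_le_div_iff₀ hd0 hc]
    rw [div_le_iff₀ hy] at hd
    linarith
  have h6 := Real.add_one_le_exp (y / c)
  linarith

lemma cube_exp (a y : ℝ) (ha : 0 < a) (hy : 0 < y) :
    (a * y) ^ 3 * Real.exp (-(3 * (a * y))) ≤ 1 / 20 := by
  have h := Real.add_one_le_exp (a * y - 1)
  have h1 : (a * y) ^ 3 ≤ Real.exp (a * y - 1) ^ 3 :=
    pow_le_pow_left₀ (by positivity) (by linarith) 3
  rw [← Real.exp_nat_mul] at h1
  calc _ ≤ Real.exp ((3 : ℕ) * (a * y - 1)) * Real.exp (-(3 * (a * y))) := by gcongr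
    _ = Real.exp (-3) := by rw [← Real.exp_add]; congr 1; push_cast; ring
    _ ≤ _ := exp_neg_three

lemma row0 (t x y : ℝ) (ht : 3 ≤ t) (hy : 0 < y) :
    6 * Real.exp (-(t / y)) ≤ ∑' m : ℤ, bb t x y 0 m := by
  have hs := summable_bb_row t x y (by linarith) hy 0
  have h := hs.sum_le_tsum {1, -1} (fun m _ => by
    unfold bb
    have h := Ex_pos t x y (m, 0)
    have ht0 : 0 < t := by linarith
    push_cast
    have : 0 ≤ t * (((m : ℝ) + 0 * x) ^ 2 - (0 : ℝ) ^ 2 * y ^ 2) ^ 2 * Ex t x y (m, 0) := by positivity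
    linarith)
  refine le_trans ?_ h
  rw [Finset.sum_pair (by norm_num)]
  have e := Real.exp_pos (-(t / y))
  have e1 : bb t x y 0 1 = t * Real.exp (-(t / y)) := by
    unfold bb Ex; norm_num
  have e2 : bb t x y 0 (-1) = t * Real.exp (-(t / y)) := by
    unfold bb Ex; norm_num
  rw [e1, e2]
  nlinarith

lemma row1 (t x y : ℝ) (ht : 3 ≤ t) (hx0 : 0 ≤ x) (hx1 : x ≤ 1 / 2) (hy : 0 < y)
    (hy34 : 3 / 4 ≤ y ^ 2) (hxy : 1 ≤ x ^ 2 + y ^ 2) :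
    -(2.85 * Real.exp (-(t / y))) ≤ ∑' m : ℤ, bb t x y 1 m := by
  have ht0 : 0 < t := by linarith
  have hy86 : 0.866 ≤ y := by nlinarith
  have h := tsum_int_pair _ (summable_bb_row t x y ht0 hy 1)
  rw [← hasSum_nat_add_iff' 1] at h
  simp only [Finset.sum_range_one] at h
  set E := Real.exp (-(t / y)) with hE
  have hE0 : 0 < E := Real.exp_pos _
  have hs3 : 3 / y ≤ t / y := by gcongr
  have hs0 : 0 < t / y := by positivity
  have hsy : t / y * y = t := by field_simp
  -- first term
  have a1 : -(0.6 * E) ≤ bb t x y 1 0 := by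
    unfold bb
    push_cast
    have hEx : Ex t x y (0, 1) ≤ E := by
      unfold Ex
      rw [hE, Real.exp_le_exp]
      push_cast
      nlinarith
    have hp := Ex_pos t x y (0, 1)
    have hc : -0.6 ≤ t * ((0 + 1 * x) ^ 2 - 1 ^ 2 * y ^ 2) ^ 2 - 2 * 1 ^ 2 * y ^ 3 := by
      have b1 : (y ^ 2 - 1 / 4) ^ 2 ≤ ((0 + 1 * x) ^ 2 - 1 ^ 2 * y ^ 2) ^ 2 := by
        have b0 : x ^ 2 ≤ 1 / 4 := by nlinarith
        have e : ((0 + 1 * x) ^ 2 - 1 ^ 2 * y ^ 2) ^ 2 = (y ^ 2 - x ^ 2) ^ 2 := by ring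
        rw [e]
        exact pow_le_pow_left₀ (by linarith) (by linarith) 2
      have b2 : 3 * (y ^ 2 - 1 / 4) ^ 2 ≤ t * ((0 + 1 * x) ^ 2 - 1 ^ 2 * y ^ 2) ^ 2 := by gcongr
      have b3 : -0.6 ≤ 3 * (y ^ 2 - 1 / 4) ^ 2 - 2 * y ^ 3 := by
        have : 0 ≤ y - 0.866 := by linarith
        nlinarith [mul_nonneg this this, mul_nonneg (mul_nonneg this this) this, sq_nonneg ((y - 0.866) ^ 2)]
      linarith
    nlinarith
  have a2 : -(2 * E) ≤ bb t x y 1 (-1) := by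
    refine le_trans ?_ (bb_ge t x y ht0 1 (-1))
    push_cast
    set w := (y ^ 2 - 3 / 4) / y with hw
    have hwy : w * y = y ^ 2 - 3 / 4 := by rw [hw]; field_simp
    have hw0 : 0 ≤ w := div_nonneg (by linarith) hy.le
    have hEx : Ex t x y (-1, 1) ≤ E * Real.exp (-(3 * w)) := by
      unfold Ex
      rw [hE, ← Real.exp_add, Real.exp_le_exp]
      push_cast
      have b1 : y ^ 2 + 1 / 4 ≤ (-1 + 1 * x) ^ 2 + 1 ^ 2 * y ^ 2 := by nlinarith
      have b2 : t / y * (y ^ 2 + 1 / 4) ≤ t / y * ((-1 + 1 * x) ^ 2 + 1 ^ 2 * y ^ 2) := by gcongr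
      have b3 : t / y * (y ^ 2 + 1 / 4) = t / y + t * w := by rw [hw]; field_simp; ring
      have b4 : 3 * w ≤ t * w := by gcongr
      linarith
    have hyw : y ≤ Real.exp w := by
      have := Real.add_one_le_exp w
      have : y ≤ w + 1 := by
        nlinarith
      linarith
    have h3 : y ^ 3 ≤ Real.exp (3 * w) := by
      have := pow_le_pow_left₀ hy.le hyw 3
      rw [← Real.exp_nat_mul] at this
      exact_mod_cast this
    have h4 : y ^ 3 * Ex t x y (-1, 1) ≤ E := by
      calc _ ≤ Real.exp (3 * w) * (E * Real.exp (-(3 * w))) := by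
            gcongr
            exact (Ex_pos _ _ _ _).le
        _ = E := by rw [mul_left_comm, ← Real.exp_add]; simp
    linarith
  have hr1 : Real.exp (-(3 * (t / y))) < 1 := by rw [Real.exp_lt_one_iff]; linarith
  have hgeo := (hasSum_geometric_of_lt_one (Real.exp_pos (-(3 * (t / y)))).le hr1).mul_left
    (-(4 * y ^ 3 * Real.exp (-(t * y)) * E))
  have hle := hasSum_le (fun j => ?_) hgeo h
  · have hi := geom_inv 9 (3 * (t / y)) y (by norm_num) hy (by
      have : 9 / y = 3 * (3 / y) := by ring
      linarith)
    have hc := cube_exp (26 / 27) y (by norm_num) hy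
    have hb : y ^ 3 * Real.exp (-(t * y)) * (1 - Real.exp (-(3 * (t / y))))⁻¹ ≤ 0.06 := by
      calc _ ≤ y ^ 3 * Real.exp (-(3 * y)) * Real.exp (y / 9) := by
            gcongr
        _ = (27 / 26) ^ 3 * ((26 / 27 * y) ^ 3 * Real.exp (-(3 * (26 / 27 * y)))) := by
            rw [mul_assoc, ← Real.exp_add]
            have : -(3 * y) + y / 9 = -(3 * (26 / 27 * y)) := by ring
            rw [this]; ring
        _ ≤ (27 / 26) ^ 3 * (1 / 20) := by gcongr
        _ ≤ _ := by norm_num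
    have hb2 := mul_le_mul_of_nonneg_left hb hE0.le
    simp only [Nat.cast_zero, zero_add] at hle
    linarith
  · have c1 := bb_ge t x y ht0 1 ((j + 1 : ℕ) : ℤ)
    have c2 := bb_ge t x y ht0 1 (-(((j + 1 : ℕ) : ℤ) + 1))
    have hj : (0 : ℝ) ≤ j := by positivity
    have key : ∀ v : ℝ, ((j : ℝ) + 1) ^ 2 ≤ v → Real.exp (-(t / y) * (v + 1 ^ 2 * y ^ 2)) ≤
        Real.exp (-(t * y)) * E * Real.exp (-(3 * (t / y))) ^ j := by
      intro v hv
      rw [hE, ← Real.exp_nat_mul, ← Real.exp_add, ← Real.exp_add, Real.exp_le_exp]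
      have b1 : t / y * y ^ 2 = t * y := by field_simp
      have b2 : 1 + 3 * (j : ℝ) ≤ v := by
        have : (j : ℝ) ≤ (j : ℝ) ^ 2 := by
          rcases Nat.eq_zero_or_pos j with h | h
          · simp [h]
          · have : (1 : ℝ) ≤ j := by exact_mod_cast h
            nlinarith
        nlinarith
      have b3 : t / y * (1 + 3 * (j : ℝ)) ≤ t / y * v := by gcongr
      linarith
    have k1 : Ex t x y (((j + 1 : ℕ) : ℤ), 1) ≤ Real.exp (-(t * y)) * E * Real.exp (-(3 * (t / y))) ^ j := by
      unfold Ex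
      push_cast
      exact key _ (by nlinarith)
    have k2 : Ex t x y (-(((j + 1 : ℕ) : ℤ) + 1), 1) ≤ Real.exp (-(t * y)) * E * Real.exp (-(3 * (t / y))) ^ j := by
      unfold Ex
      push_cast
      exact key _ (by nlinarith)
    have hy3 : 0 < y ^ 3 := by positivity
    have k3 := mul_le_mul_of_nonneg_left (add_le_add k1 k2) hy3.le
    simp only [Int.cast_one, one_pow, mul_one] at c1 c2
    linarith

lemma row2 (t x y : ℝ) (ht : 3 ≤ t) (hy : 0 < y) (hy34 : 3 / 4 ≤ y ^ 2) (k : ℕ) :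
    -(0.2 * ((k : ℝ) + 2) ^ 2 * Real.exp (-2) ^ (k + 2) * Real.exp (-(t / y))) ≤
      ∑' m : ℤ, bb t x y ((k + 2 : ℕ) : ℤ) m := by
  have ht0 : 0 < t := by linarith
  have hy86 : 0.866 ≤ y := by nlinarith
  have hs0 : 0 < t / y := by positivity
  set N : ℤ := ((k + 2 : ℕ) : ℤ) with hN
  set n : ℝ := (k : ℝ) + 2 with hn
  have hNn : (N : ℝ) = n := by rw [hN, hn]; push_cast; ring
  have hn2 : 2 ≤ n := by rw [hn]; linarith [(Nat.cast_nonneg k : (0 : ℝ) ≤ k)]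
  have hg := summable_gauss (t / y) (n * x) hs0
  have hgl := gauss_sum_le (t / y) (n * x) hs0
  set G := ∑' m : ℤ, Real.exp (-(t / y) * ((m : ℝ) + n * x) ^ 2) with hG
  have h1 : -(2 * n ^ 2 * y ^ 3 * Real.exp (-(t * n ^ 2 * y))) * G ≤ ∑' m : ℤ, bb t x y N m := by
    rw [hG, ← tsum_mul_left]
    refine (hg.mul_left _).tsum_le_tsum (fun m => ?_) (summable_bb_row t x y ht0 hy N)
    have := bb_ge t x y ht0 N m
    rw [Ex_split t x y hy, hNn] at this
    linarith
  refine le_trans ?_ h1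
  have hi := geom_inv 3 (t / y) y (by norm_num) hy (by gcongr)
  have hGe : G ≤ 2 * Real.exp (y / 3) := by linarith
  have hc := cube_exp 1 y one_pos hy
  rw [one_mul] at hc
  have hexp : Real.exp (-(t * n ^ 2 * y)) * Real.exp (y / 3) ≤
      Real.exp (-(3 * y)) * (Real.exp (-2) ^ (k + 2) * Real.exp (-(t / y))) := by
    rw [← Real.exp_nat_mul, ← Real.exp_add, ← Real.exp_add, ← Real.exp_add, Real.exp_le_exp]
    have hk : ((k + 2 : ℕ) : ℝ) = n := by rw [hn]; push_cast; ring
    rw [hk]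
    have h14 : t / y ≤ t * y * (4 / 3) := by
      rw [div_le_iff₀ hy]
      nlinarith
    have hn3 : 4 / 3 * n ≤ n ^ 2 - 4 / 3 := by nlinarith
    have hty : 3 * y ≤ t * y := by gcongr
    have h5 := mul_le_mul hty hn3 (by linarith) (by positivity)
    have h6 : 2 * n ≤ y * (4 * n - 10 / 3) := by
      have : 0.866 * (4 * n - 10 / 3) ≤ y * (4 * n - 10 / 3) := by
        apply mul_le_mul_of_nonneg_right hy86; linarith
      linarith
    linarith
  have hfin : 2 * n ^ 2 * y ^ 3 * Real.exp (-(t * n ^ 2 * y)) * G ≤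
      0.2 * n ^ 2 * Real.exp (-2) ^ (k + 2) * Real.exp (-(t / y)) := by
    calc _ ≤ 2 * n ^ 2 * y ^ 3 * Real.exp (-(t * n ^ 2 * y)) * (2 * Real.exp (y / 3)) := by gcongr
      _ = 4 * n ^ 2 * y ^ 3 * (Real.exp (-(t * n ^ 2 * y)) * Real.exp (y / 3)) := by ring
      _ ≤ 4 * n ^ 2 * y ^ 3 * (Real.exp (-(3 * y)) * (Real.exp (-2) ^ (k + 2) * Real.exp (-(t / y)))) := by
          gcongr
      _ = 4 * n ^ 2 * (Real.exp (-2) ^ (k + 2) * Real.exp (-(t / y))) * (y ^ 3 * Real.exp (-(3 * y))) := by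
          ring
      _ ≤ 4 * n ^ 2 * (Real.exp (-2) ^ (k + 2) * Real.exp (-(t / y))) * (1 / 20) := by gcongr
      _ = _ := by ring
  linarith

lemma B_pos (t x y : ℝ) (ht : 3 ≤ t) (hx0 : 0 ≤ x) (hx1 : x ≤ 1 / 2) (hy : 0 < y)
    (hxy : 1 ≤ x ^ 2 + y ^ 2) : 0 < ∑' p, Bc t x y p * Ex t x y p := by
  have ht0 : 0 < t := by linarith
  have hy34 : 3 / 4 ≤ y ^ 2 := by nlinarith
  simp_rw [Bc_eq t x y hy]
  rw [tsum_mul_left]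
  apply mul_pos (by positivity)
  rw [tsum_prod_swap _ (summable_bb t x y ht0 hy)]
  have hsum := summable_inner _ (summable_bb t x y ht0 hy)
  simp only at hsum ⊢
  set f : ℤ → ℝ := fun n => ∑' m : ℤ, bb t x y n m with hf
  have hfn : ∀ n : ℤ, f (-n) = f n := by
    intro n
    simp only [hf]
    rw [← (Equiv.neg ℤ).tsum_eq]
    refine tsum_congr fun m => ?_
    rw [Equiv.neg_apply, bb_neg]
  have h1 := hsum.hasSum.nat_add_neg
  have h1' : HasSum (fun k : ℕ => 2 * f k) (∑' n, f n + f 0) := by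
    have e : (fun k : ℕ => 2 * f k) = (fun k : ℕ => f k + f (-(k : ℤ))) := by
      funext k; rw [hfn]; ring
    rw [e]
    exact h1
  rw [← hasSum_nat_add_iff' 2] at h1'
  simp only [Finset.sum_range_succ, Finset.sum_range_zero, zero_add] at h1'
  have r0 := row0 t x y ht hy
  have r1 := row1 t x y ht hx0 hx1 hy hy34 hxy
  set E := Real.exp (-(t / y)) with hE
  have hE0 : 0 < E := Real.exp_pos _
  have e2 : Real.exp (-2) ≤ 1 / 7 := by
    rw [Real.exp_neg, one_div]
    apply inv_anti₀ (by norm_num)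
    have h : Real.exp 2 = Real.exp 1 ^ 2 := by rw [← Real.exp_nat_mul]; norm_num
    rw [h]
    nlinarith [Real.exp_one_gt_d9]
  have hgeo := (hasSum_geometric_of_lt_one (r := 9 / 28) (by norm_num) (by norm_num)).mul_left
    (-(1.6 / 49 * E))
  have hle := hasSum_le (fun k => ?_) hgeo h1'
  · simp only [Nat.cast_zero, Nat.cast_one] at hle
    change 6 * E ≤ f 0 at r0
    change -(2.85 * E) ≤ f 1 at r1
    norm_num at hle
    linarith
  · have r2 := row2 t x y ht hy hy34 k
    change _ ≤ f _ at r2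
    have hq := sq_le_geom k
    have hb : ((k : ℝ) + 2) ^ 2 * Real.exp (-2) ^ (k + 2) ≤ 4 * (9 / 4) ^ k * (1 / 7) ^ (k + 2) := by
      gcongr
    have hb2 : (4 : ℝ) * (9 / 4) ^ k * (1 / 7) ^ (k + 2) = 4 / 49 * (9 / 28) ^ k := by
      rw [pow_add, show (9 / 28 : ℝ) = 9 / 4 * (1 / 7) by norm_num, mul_pow]; ring
    rw [hb2] at hb
    have hb3 := mul_le_mul_of_nonneg_right hb hE0.le
    linarith

lemma main_large (t : ℝ) (ht : 3 ≤ t) (x y : ℝ)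
    (hx0 : 0 ≤ x) (hx1 : x ≤ 1 / 2) (hy : 0 < y) (hxy : 1 ≤ x ^ 2 + y ^ 2) :
    0 ≤ deriv (fun y' : ℝ => theta t x y') y ∧
    (deriv (fun y' : ℝ => theta t x y') y = 0 ↔
      (x = 0 ∧ y = 1) ∨ (x = 1 / 2 ∧ y = Real.sqrt 3 / 2)) := by
  have ht0 : 0 < t := by linarith
  have hx2 : x ^ 2 ≤ 1 / 4 := by nlinarith
  rw [(deriv_theta t x y ht0 hy).deriv]
  set A : ℝ → ℝ := fun z => ∑' p, Ac t x z p * Ex t x z p with hA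
  change 0 ≤ A y / y ^ 2 ∧ (A y / y ^ 2 = 0 ↔ _)
  set y0 := Real.sqrt (1 - x ^ 2) with hy0
  have hsq : y0 ^ 2 = 1 - x ^ 2 := Real.sq_sqrt (by linarith)
  have hy0p : 0 < y0 := Real.sqrt_pos.mpr (by linarith)
  have hy01 : y0 ≤ 1 := by nlinarith
  have hyy : y0 ≤ y := by
    rw [hy0, Real.sqrt_le_left hy.le]
    linarith
  have hmono : StrictMonoOn A (Set.Ici y0) := by
    apply strictMonoOn_of_deriv_pos (convex_Ici y0)
    · intro z hz
      exact (hasDerivAt_sumAc t x z ht0 (lt_of_lt_of_le hy0p hz)).continuousAt.continuousWithinAt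
    · intro z hz
      rw [interior_Ici] at hz
      have hz' : y0 < z := hz
      have hz0 : 0 < z := hy0p.trans hz'
      rw [(hasDerivAt_sumAc t x z ht0 hz0).deriv]
      exact B_pos t x z ht hx0 hx1 hz0 (by nlinarith)
  have hA0 : A y0 = 2 * x * t * ∑' p, Sc x p * Ex t x y0 p :=
    A_arc t x y0 ht0 hy0p (by linarith)
  have hy2 : 0 < y ^ 2 := by positivity
  have hle : A y0 ≤ A y := hmono.monotoneOn (Set.mem_Ici.mpr le_rfl) (Set.mem_Ici.mpr hyy) hyy
  have hcase : (A y0 = 0 ∧ (x = 0 ∨ x = 1 / 2)) ∨ (0 < A y0 ∧ x ≠ 0 ∧ x ≠ 1 / 2) := by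
    rcases hx0.eq_or_lt with h | h
    · left; refine ⟨?_, Or.inl h.symm⟩
      rw [hA0, ← h]; ring
    rcases hx1.eq_or_lt with h' | h'
    · left; refine ⟨?_, Or.inr h'⟩
      rw [hA0, h', S_half t y0 ht0 hy0p, mul_zero]
    · right
      refine ⟨?_, h.ne', h'.ne⟩
      rw [hA0]
      have := S_pos t x y0 ht h h' hy0p hy01 (by linarith)
      positivity
  have hyeq : ((x = 0 ∧ y = 1) ∨ (x = 1 / 2 ∧ y = Real.sqrt 3 / 2)) ↔ ((x = 0 ∨ x = 1 / 2) ∧ y = y0) := by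
    have e1 : x = 0 → y0 = 1 := by
      intro h; rw [hy0, h]; norm_num
    have e2 : x = 1 / 2 → y0 = Real.sqrt 3 / 2 := by
      intro h
      rw [hy0, h, Real.sqrt_eq_iff_mul_self_eq (by norm_num) (by positivity)]
      nlinarith [Real.sq_sqrt (show (0 : ℝ) ≤ 3 by norm_num)]
    constructor
    · rintro (⟨h, h'⟩ | ⟨h, h'⟩)
      · exact ⟨Or.inl h, by rw [e1 h, h']⟩
      · exact ⟨Or.inr h, by rw [e2 h, h']⟩
    · rintro ⟨h | h, h'⟩
      · exact Or.inl ⟨h, by rw [h', e1 h]⟩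
      · exact Or.inr ⟨h, by rw [h', e2 h]⟩
  rw [hyeq]
  have hnn : 0 ≤ A y := by rcases hcase with ⟨h, _⟩ | ⟨h, _⟩ <;> linarith
  refine ⟨div_nonneg hnn hy2.le, ?_⟩
  rw [div_eq_zero_iff, or_iff_left hy2.ne']
  constructor
  · intro h
    rcases hcase with ⟨h0, hx⟩ | ⟨h0, _⟩
    · refine ⟨hx, ?_⟩
      by_contra hne
      have hlt : y0 < y := lt_of_le_of_ne hyy (Ne.symm hne)
      have := hmono (Set.mem_Ici.mpr le_rfl) (Set.mem_Ici.mpr hyy) hlt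
      linarith
    · linarith
  · rintro ⟨hx, h⟩
    rcases hcase with ⟨h0, _⟩ | ⟨_, h1, h2⟩
    · rw [h, h0]
    · rcases hx with hx | hx
      · exact absurd hx h1
      · exact absurd hx h2

/-- Montgomery's second monotonicity property: for `t > 0`, `0 ≤ x ≤ 1/2`, `y > 0`
with `x² + y² ≥ 1`, the derivative of `y ↦ θ(t; x, y)` is nonnegative, vanishing
exactly at the ramification points `(0, 1)` and `(1/2, √3/2)` of the modular
surface. -/
theorem theta_deriv_y_nonneg
    (t : ℝ) (ht : 0 < t) (x y : ℝ)
    (hx0 : 0 ≤ x) (hx1 : x ≤ 1 / 2) (hy : 0 < y) (hxy : 1 ≤ x ^ 2 + y ^ 2) :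
    0 ≤ deriv (fun y' : ℝ => theta t x y') y ∧
    (deriv (fun y' : ℝ => theta t x y') y = 0 ↔
      (x = 0 ∧ y = 1) ∨ (x = 1 / 2 ∧ y = Real.sqrt 3 / 2)) := by
  rcases le_total 3 t with h | h
  · exact main_large t h x y hx0 hx1 hy hxy
  · have h3 : 3 ≤ Real.pi ^ 2 / t := by
      rw [le_div_iff₀ ht]
      nlinarith [Real.pi_gt_three]
    obtain ⟨h1, h2⟩ := main_large (Real.pi ^ 2 / t) h3 x y hx0 hx1 hy hxy
    have hc : 0 < Real.pi / t := div_pos Real.pi_pos ht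
    rw [deriv_theta_dual t x y ht hy]
    refine ⟨mul_nonneg hc.le h1, ?_⟩
    rw [mul_eq_zero, or_iff_right hc.ne']
    exact h2
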